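/- Let R = ℂ[a₁, a₂, a₃, b₁, b₂, b₃, c₁, c₂, c₃, d₁, d₂, d₃] and let I ⊆ R be the ideal generated by the six incidence polynomials c₂ + a₁d₂ + b₁, c₃ + a₁d₃ + b₁, c₁ + a₂d₁ + b₂, c₃ + a₂d₃ + b₂, c₁ + a₃d₁ + b₃, c₂ + a₃d₂ + b₃. Then the Krull dimension of the quotient ring R/I equals 6. -/

import Mathlib

open MvPolynomial

/-- The incidence ideal of the space of triangles `I₃,₃` in affine coordinates.
The variables of `MvPolynomial (Fin 12) ℂ` are identified as
`0 ↦ a₁`, `1 ↦ a₂`, `2 ↦ a₃`, `3 ↦ b₁`, `4 ↦ b₂`, `5 ↦ b₃`,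
`6 ↦ c₁`, `7 ↦ c₂`, `8 ↦ c₃`, `9 ↦ d₁`, `10 ↦ d₂`, `11 ↦ d₃`. -/
noncomputable def incidenceIdeal : Ideal (MvPolynomial (Fin 12) ℂ) :=
  Ideal.span
    { X 7 + X 0 * X 10 + X 3,   -- c₂ + a₁ d₂ + b₁
      X 8 + X 0 * X 11 + X 3,   -- c₃ + a₁ d₃ + b₁
      X 6 + X 1 * X 9 + X 4,    -- c₁ + a₂ d₁ + b₂
      X 8 + X 1 * X 11 + X 4,   -- c₃ + a₂ d₃ + b₂
      X 6 + X 2 * X 9 + X 5,    -- c₁ + a₃ d₁ + b₃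
      X 7 + X 2 * X 10 + X 5 }  -- c₂ + a₃ d₂ + b₃

namespace MvPolynomial

variable {σ K : Type*} [Field K]

/-- The translation automorphism `X i ↦ X i + C (x i)` of a polynomial ring. -/
noncomputable def translate (x : σ → K) : MvPolynomial σ K ≃ₐ[K] MvPolynomial σ K :=
  AlgEquiv.ofAlgHom (aeval fun i ↦ X i + C (x i)) (aeval fun i ↦ X i - C (x i))
    (by ext i; simp [← algebraMap_eq]) (by ext i; simp [← algebraMap_eq])

theorem aeval_translate (x y : σ → K) (p : MvPolynomial σ K) :
    aeval y (translate x p) = aeval (y + x) p := by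
  change ((aeval y).comp (aeval fun i ↦ X i + C (x i))) p = _
  congr 1
  ext i
  simp

theorem height_vanishingIdeal_singleton_eq (x y : σ → K) :
    (vanishingIdeal K {x}).height = (vanishingIdeal K {y}).height := by
  rw [← (translate (x - y)).toRingEquiv.height_comap (vanishingIdeal K {y})]
  congr 1
  ext p
  simp [Ideal.mem_comap, aeval_translate]

theorem height_vanishingIdeal_singleton [Finite σ] [IsAlgClosed K] (x : σ → K) :
    (vanishingIdeal K {x}).height = Nat.card σ := by
  have hdim : ringKrullDim (MvPolynomial σ K) = Nat.card σ := by simp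
  rw [← Ideal.sup_isMaximal_height_eq_ringKrullDim] at hdim
  replace hdim : ⨆ (I : Ideal (MvPolynomial σ K)) (_ : I.IsMaximal), I.height = Nat.card σ :=
    mod_cast hdim
  rw [← hdim]
  refine le_antisymm
    (le_iSup₂_of_le _ (isMaximal_iff_eq_vanishingIdeal_singleton.mpr ⟨x, rfl⟩) le_rfl)
    (iSup₂_le fun I hI ↦ ?_)
  obtain ⟨y, rfl⟩ := isMaximal_iff_eq_vanishingIdeal_singleton.mp hI
  exact (height_vanishingIdeal_singleton_eq y x).le

end MvPolynomial

theorem six_le_ringKrullDim_incidence_quotient :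
    6 ≤ ringKrullDim (MvPolynomial (Fin 12) ℂ ⧸ incidenceIdeal) := by
  have h := Ideal.height_le_ringKrullDim_quotient_add_encard
    (p := vanishingIdeal ℂ {(0 : Fin 12 → ℂ)})
    { X 7 + X 0 * X 10 + X 3, X 8 + X 0 * X 11 + X 3, X 6 + X 1 * X 9 + X 4,
      X 8 + X 1 * X 11 + X 4, X 6 + X 2 * X 9 + X 5, X 7 + X 2 * X 10 + X 5 }
    (by simp [Set.insert_subset_iff])
  rw [height_vanishingIdeal_singleton] at h
  have hcard (a b c d e f : MvPolynomial (Fin 12) ℂ) :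
      ({a, b, c, d, e, f} : Set (MvPolynomial (Fin 12) ℂ)).encard ≤ 6 := by
    classical
    rw [show ({a, b, c, d, e, f} : Set (MvPolynomial (Fin 12) ℂ)) =
      (({a, b, c, d, e, f} : Finset _) : Set _) by simp, Set.encard_coe_eq_coe_finsetCard]
    exact_mod_cast Finset.card_le_six
  have h12 : (12 : WithBot ℕ∞) ≤
      ringKrullDim (MvPolynomial (Fin 12) ℂ ⧸ incidenceIdeal) + 6 := by
    refine le_trans (by simp) (h.trans (add_le_add_right ?_ _))
    exact WithBot.coe_le_coe.mpr (hcard ..)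
  rw [show (12 : WithBot ℕ∞) = 6 + 6 by norm_num] at h12
  exact ENat.WithBot.add_le_add_natCast_right_iff (c := 6).mp h12

/-- The incidence relation left after eliminating `b₁, b₂, b₃, c₁, c₃`, in the variables
`a₁, a₂, a₃, c₂, d₁, d₂, d₃`. -/
noncomputable def reducedIncidence : MvPolynomial (Fin 7) ℂ :=
  X 1 * (X 4 - X 6) - X 2 * (X 4 - X 5) - X 0 * (X 5 - X 6)

theorem reducedIncidence_ne_zero : reducedIncidence ≠ 0 := by
  intro h
  simpa [reducedIncidence] using congrArg (eval ![0, 1, 0, 0, 1, 0, 0]) h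

theorem ringKrullDim_incidence_quotient_add_one_le :
    ringKrullDim (MvPolynomial (Fin 12) ℂ ⧸ incidenceIdeal) + 1 ≤ 7 := by
  let q : MvPolynomial (Fin 12) ℂ →ₐ[ℂ] MvPolynomial (Fin 12) ℂ ⧸ incidenceIdeal :=
    Ideal.Quotient.mkₐ ℂ incidenceIdeal
  let φ : MvPolynomial (Fin 7) ℂ →ₐ[ℂ] MvPolynomial (Fin 12) ℂ ⧸ incidenceIdeal :=
    aeval ![q (X 0), q (X 1), q (X 2), q (X 7), q (X 9), q (X 10), q (X 11)]
  have hq {p : MvPolynomial (Fin 12) ℂ} (hp : p ∈ ({ X 7 + X 0 * X 10 + X 3,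
      X 8 + X 0 * X 11 + X 3, X 6 + X 1 * X 9 + X 4, X 8 + X 1 * X 11 + X 4,
      X 6 + X 2 * X 9 + X 5, X 7 + X 2 * X 10 + X 5 } : Set (MvPolynomial (Fin 12) ℂ))) :
      q p = 0 := Ideal.Quotient.eq_zero_iff_mem.mpr (Ideal.subset_span hp)
  have h1 : q (X 7) + q (X 0) * q (X 10) + q (X 3) = 0 :=
    hq (p := X 7 + X 0 * X 10 + X 3) (by simp)
  have h2 : q (X 8) + q (X 0) * q (X 11) + q (X 3) = 0 :=
    hq (p := X 8 + X 0 * X 11 + X 3) (by simp)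
  have h3 : q (X 6) + q (X 1) * q (X 9) + q (X 4) = 0 :=
    hq (p := X 6 + X 1 * X 9 + X 4) (by simp)
  have h4 : q (X 8) + q (X 1) * q (X 11) + q (X 4) = 0 :=
    hq (p := X 8 + X 1 * X 11 + X 4) (by simp)
  have h5 : q (X 6) + q (X 2) * q (X 9) + q (X 5) = 0 :=
    hq (p := X 6 + X 2 * X 9 + X 5) (by simp)
  have h6 : q (X 7) + q (X 2) * q (X 10) + q (X 5) = 0 :=
    hq (p := X 7 + X 2 * X 10 + X 5) (by simp)
  have hφ : φ reducedIncidence = 0 := by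
    suffices q (X 1) * (q (X 9) - q (X 11)) - q (X 2) * (q (X 9) - q (X 10)) -
        q (X 0) * (q (X 10) - q (X 11)) = 0 by simpa [φ, reducedIncidence] using this
    linear_combination h3 - h4 - h5 + h6 - h1 + h2
  have m0 : q (X 0) ∈ φ.range := ⟨X 0, by simp [φ]⟩
  have m1 : q (X 1) ∈ φ.range := ⟨X 1, by simp [φ]⟩
  have m2 : q (X 2) ∈ φ.range := ⟨X 2, by simp [φ]⟩
  have m7 : q (X 7) ∈ φ.range := ⟨X 3, by simp [φ]⟩
  have m9 : q (X 9) ∈ φ.range := ⟨X 4, by simp [φ]⟩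
  have m10 : q (X 10) ∈ φ.range := ⟨X 5, by simp [φ]⟩
  have m11 : q (X 11) ∈ φ.range := ⟨X 6, by simp [φ]⟩
  have m3 : q (X 3) ∈ φ.range := by
    rw [show q (X 3) = -(q (X 7) + q (X 0) * q (X 10)) by linear_combination h1]
    exact neg_mem (add_mem m7 (mul_mem m0 m10))
  have m8 : q (X 8) ∈ φ.range := by
    rw [show q (X 8) = -(q (X 0) * q (X 11) + q (X 3)) by linear_combination h2]
    exact neg_mem (add_mem (mul_mem m0 m11) m3)
  have m4 : q (X 4) ∈ φ.range := by
    rw [show q (X 4) = -(q (X 8) + q (X 1) * q (X 11)) by linear_combination h4]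
    exact neg_mem (add_mem m8 (mul_mem m1 m11))
  have m5 : q (X 5) ∈ φ.range := by
    rw [show q (X 5) = -(q (X 7) + q (X 2) * q (X 10)) by linear_combination h6]
    exact neg_mem (add_mem m7 (mul_mem m2 m10))
  have m6 : q (X 6) ∈ φ.range := by
    rw [show q (X 6) = -(q (X 1) * q (X 9) + q (X 4)) by linear_combination h3]
    exact neg_mem (add_mem (mul_mem m1 m9) m4)
  have hsurj : Function.Surjective φ := by
    intro z
    obtain ⟨p, rfl⟩ := Ideal.Quotient.mkₐ_surjective ℂ incidenceIdeal z
    change q p ∈ φ.range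
    induction p using MvPolynomial.induction_on with
    | C a => exact q.commutes a ▸ φ.range.algebraMap_mem a
    | add p r hp hr => rw [map_add]; exact add_mem hp hr
    | mul_X p i hp =>
      rw [map_mul]
      refine mul_mem hp ?_
      fin_cases i <;> assumption
  have h := ringKrullDim_succ_le_of_surjective φ.toRingHom hsurj
    (mem_nonZeroDivisors_of_ne_zero reducedIncidence_ne_zero) hφ
  simpa using h

/-- The Krull dimension of the quotient of `ℂ[a₁,…,d₃]` by the six incidence
polynomials equals `6`. -/
theorem incidence_quotient_krullDim :
    ringKrullDim (MvPolynomial (Fin 12) ℂ ⧸ incidenceIdeal) = 6 := by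
  refine le_antisymm ?_ six_le_ringKrullDim_incidence_quotient
  have h := ringKrullDim_incidence_quotient_add_one_le
  rw [show (7 : WithBot ℕ∞) = 6 + 1 by norm_num] at h
  exact ENat.WithBot.add_le_add_one_right_iff.mp h
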